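/- Let π be an infinite stationary measure for the transition kernel p on a countable state space V. Suppose 0 < γ ≤ 1/2 and p(x,x) ≥ γ for all x ∈ V. Then for every ε > 0 and all x, y ∈ V, if n ≥ 1 + ((1−γ)²/γ²) ∫_{4(π(x) ∧ π(y))}^{4/ε} (4/(u Φ(u)²)) du, then p^n(x,y)/π(y) ≤ ε. -/

import Mathlib

open MeasureTheory Set
open scoped ENNReal Classical

namespace EvolvingSetsPaper

variable {V : Type*}

/-- `π(S) = ∑_{y ∈ S} π(y)`. -/
noncomputable def piS (pi : V → ℝ) (S : Set V) : ℝ := ∑' y : S, pi y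

/-- `Q(S, y) = ∑_{s ∈ S} π(s) p(s, y)`. -/
noncomputable def QS (pi : V → ℝ) (p : V → V → ℝ) (S : Set V) (y : V) : ℝ :=
  ∑' s : S, pi s * p s y

/-- `Q(S, A) = ∑_{s ∈ S, a ∈ A} π(s) p(s, a)`. -/
noncomputable def Qset (pi : V → ℝ) (p : V → V → ℝ) (S A : Set V) : ℝ :=
  ∑' a : A, QS pi p S a

/-- The conductance `Φ_S = Q(S, Sᶜ)/π(S)`. -/
noncomputable def cond (pi : V → ℝ) (p : V → V → ℝ) (S : Set V) : ℝ :=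
  Qset pi p S Sᶜ / piS pi S

/-- The conductance profile `Φ(r)`, constant for `r > 1/2`. -/
noncomputable def profile (pi : V → ℝ) (p : V → V → ℝ) (r : ℝ) : ℝ :=
  if r ≤ 1 / 2 then sInf (cond pi p '' {S : Set V | 0 < piS pi S ∧ piS pi S ≤ r})
  else sInf (cond pi p '' {S : Set V | 0 < piS pi S ∧ piS pi S ≤ 1 / 2})

/-- `n`-step transition probabilities. -/
noncomputable def pn (p : V → V → ℝ) : ℕ → V → V → ℝ
  | 0 => fun x y => if x = y then 1 else 0
  | n + 1 => fun x y => ∑' z, pn p n x z * p z y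

/-- One step of the evolving set process with uniform value `u`:
`S̃ = {y : Q(S,y) ≥ u π(y)}`. -/
def esStep (pi : V → ℝ) (p : V → V → ℝ) (S : Set V) (u : ℝ) : Set V :=
  {y | u * pi y ≤ QS pi p S y}

/-- `esE pi p n F S = E_S[F(S_n)]` for the evolving set process started at `S`,
driven by i.i.d. uniform variables on `[0,1]`. -/
noncomputable def esE (pi : V → ℝ) (p : V → V → ℝ) : ℕ → (Set V → ℝ) → Set V → ℝ
  | 0 => fun F S => F S
  | n + 1 => fun F S => ∫ u in (0:ℝ)..1, esE pi p n F (esStep pi p S u)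

/-- `ψ(S) = 1 - E_S √(π(S̃)/π(S))`. -/
noncomputable def psiSet (pi : V → ℝ) (p : V → V → ℝ) (S : Set V) : ℝ :=
  1 - ∫ u in (0:ℝ)..1, Real.sqrt (piS pi (esStep pi p S u) / piS pi S)

/-- The root profile `ψ(r)`, constant for `r > 1/2`. -/
noncomputable def rootProfile (pi : V → ℝ) (p : V → V → ℝ) (r : ℝ) : ℝ :=
  if r ≤ 1 / 2 then sInf (psiSet pi p '' {S : Set V | 0 < piS pi S ∧ piS pi S ≤ r})
  else sInf (psiSet pi p '' {S : Set V | 0 < piS pi S ∧ piS pi S ≤ 1 / 2})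

/-- `φ_S = (1/(2π(S))) ∑_y min(Q(S,y), Q(Sᶜ,y))`. -/
noncomputable def phiS (pi : V → ℝ) (p : V → V → ℝ) (S : Set V) : ℝ :=
  (1 / (2 * piS pi S)) * ∑' y, min (QS pi p S y) (QS pi p Sᶜ y)

/-- `S^♯ = S` if `π(S) ≤ 1/2`, else `Sᶜ`. -/
noncomputable def sharp (pi : V → ℝ) (S : Set V) : Set V :=
  if piS pi S ≤ 1 / 2 then S else Sᶜ

/-- `χ²(μ, π) = ∑_y π(y) (μ(y)/π(y) - 1)²`. -/
noncomputable def chiSq (pi : V → ℝ) (mu : V → ℝ) : ℝ :=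
  ∑' y, pi y * (mu y / pi y - 1) ^ 2


/-- The conductance profile in the infinite stationary measure case
(no cap at `1/2`). -/
noncomputable def profileInf (pi : V → ℝ) (p : V → V → ℝ) (r : ℝ) : ℝ :=
  sInf (cond pi p '' {S : Set V | 0 < piS pi S ∧ piS pi S ≤ r})

section Helpers

theorem real_key (γ a : ℝ) (h0 : 0 < γ) (h1 : γ ≤ 1/2) (ha : 0 ≤ a) (ha' : γ * a ≤ 1 - γ) :
    γ * √(1 + a) + (1 - γ) * √(1 - γ * a / (1 - γ)) ≤ 1 - γ ^ 2 * a ^ 2 / 2 := by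
  have hg : 0 < 1 - γ := by linarith
  have hs : 0 ≤ 1 - γ * a / (1 - γ) := by
    rw [sub_nonneg, div_le_one hg]; exact ha'
  have e1 := Real.sq_sqrt (show (0:ℝ) ≤ 1 + a by linarith)
  have e2 := Real.sq_sqrt hs
  have n1 := Real.sqrt_nonneg (1 + a)
  have n2 := Real.sqrt_nonneg (1 - γ * a / (1 - γ))
  set α := √(1 + a)
  set β := √(1 - γ * a / (1 - γ))
  have e3 : (1 - γ) * β ^ 2 = 1 - γ - γ * a := by
    rw [e2]; field_simp
  have e4 : γ * α ^ 2 + (1 - γ) * β ^ 2 = 1 := by rw [e3, e1]; ring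
  have e5 : (1 - γ) * (α ^ 2 - β ^ 2) = a := by linarith [e3, e1, congrArg (fun t => (1-γ)*t) e1]
  -- Cauchy
  have c1 : γ * (1 - γ) * (α + β) ^ 2 ≤ 1 := by
    nlinarith [sq_nonneg (γ * α - (1 - γ) * β)]
  set g := γ * α + (1 - γ) * β
  have e6 : 1 - g ^ 2 = γ * (1 - γ) * (α - β) ^ 2 := by
    simp only [g]; nlinarith
  have e7 : γ ^ 2 * a ^ 2 ≤ 1 - g ^ 2 := by
    have : γ ^ 2 * a ^ 2 = (γ * (1 - γ) * (α - β) ^ 2) * (γ * (1 - γ) * (α + β) ^ 2) := by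
      rw [← e5]; ring
    rw [this, ← e6]
    have : 0 ≤ 1 - g ^ 2 := by rw [e6]; positivity
    nlinarith
  nlinarith [sq_nonneg (1 - g)]

/-- Lower bound for the integral. -/
theorem integral_lower (F : ℝ → ℝ) (a b : ℝ) (ha : 0 < a) (hab : a ≤ b) (hF0 : ∀ u, 0 ≤ F u)
    (hF : ∀ u, a ≤ u → F u ≤ F a) :
    4 / ENNReal.ofReal (F a ^ 2) * ENNReal.ofReal (Real.log (b / a)) ≤
      ∫⁻ u in Ioc a b, 4 / ENNReal.ofReal (u * F u ^ 2) := by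
  have h1 : ENNReal.ofReal (Real.log (b / a)) = ∫⁻ u in Ioc a b, ENNReal.ofReal (u⁻¹) := by
    rw [← integral_inv_of_pos ha (ha.trans_le hab), intervalIntegral.integral_of_le hab]
    refine ofReal_integral_eq_lintegral_ofReal ?_ ?_
    · have : IntervalIntegrable (fun u : ℝ => u⁻¹) volume a b := by
        apply intervalIntegral.intervalIntegrable_inv
        · intro x hx
          rw [uIcc_of_le hab] at hx
          exact (ha.trans_le hx.1).ne'
        · exact continuousOn_id
      exact (intervalIntegrable_iff_integrableOn_Ioc_of_le hab).1 this
    · refine (ae_restrict_iff' measurableSet_Ioc).2 (Filter.Eventually.of_forall fun x hx => ?_)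
      exact inv_nonneg.2 (ha.trans hx.1).le
  rw [h1, ← lintegral_const_mul _ (by fun_prop)]
  refine setLIntegral_mono' measurableSet_Ioc fun u hu => ?_
  have hu0 : 0 < u := ha.trans hu.1
  have h2 : F u ^ 2 ≤ F a ^ 2 := pow_le_pow_left₀ (hF0 u) (hF u hu.1.le) 2
  calc 4 / ENNReal.ofReal (F a ^ 2) * ENNReal.ofReal (u⁻¹)
      = 4 / ENNReal.ofReal (u * F a ^ 2) := by
        rw [ENNReal.ofReal_mul hu0.le, ENNReal.ofReal_inv_of_pos hu0, div_eq_mul_inv, div_eq_mul_inv,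
          ENNReal.mul_inv (Or.inl (by simpa using hu0)) (Or.inl ENNReal.ofReal_ne_top)]
        ring
    _ ≤ _ := by gcongr

/-- deterministic recursion -/
theorem recursion (F : ℝ → ℝ) (hF0 : ∀ u, 0 ≤ F u) (c : ℝ) (hc : 0 < c) (L : ℕ → ℝ) (δ : ℝ) (hδ : 0 < δ)
    (hF : ∀ r r', 4 / L 0 ^ 2 ≤ r → r ≤ r' → F r' ≤ F r) (m : ℕ) (hstep : ∀ k, L (k + 1) ≤ L k)
    (hL : ∀ k, 0 < L k → L (k + 1) ≤ L k * (1 - c * F (4 / L k ^ 2) ^ 2 / 2))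
    (hI : ∫⁻ u in Ioc (4 / L 0 ^ 2) (4 / δ ^ 2), 4 / ENNReal.ofReal (u * F u ^ 2) ≤
      ENNReal.ofReal (4 * c * m)) : L m ≤ δ := by
  by_contra hcon
  push Not at hcon
  have hanti : Antitone L := antitone_nat_of_succ_le hstep
  have hpos : ∀ k ≤ m, δ < L k := fun k hk => hcon.trans_le (hanti hk)
  set a : ℕ → ℝ := fun k => 4 / L k ^ 2 with ha
  have hLpos : ∀ k ≤ m, 0 < L k := fun k hk => hδ.trans (hpos k hk)
  have hapos : ∀ k ≤ m, 0 < a k := fun k hk => by have := hLpos k hk; positivity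
  have hamono : ∀ k l, k ≤ l → l ≤ m → a k ≤ a l := by
    intro k l hkl hl
    have h1 := hLpos l hl
    have := hanti hkl
    simp only [ha]; gcongr
  have haδ : ∀ k ≤ m, a k < 4 / δ ^ 2 := by
    intro k hk
    have := hpos k hk
    simp only [ha]; gcongr
  have hfin : ∫⁻ u in Ioc (a 0) (4 / δ ^ 2), 4 / ENNReal.ofReal (u * F u ^ 2) < ⊤ :=
    hI.trans_lt ENNReal.ofReal_lt_top
  have hFk : ∀ k ≤ m, 0 < F (a k) := by
    intro k hk
    refine (hF0 _).lt_of_ne fun h => ?_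
    have h1 := integral_lower F (a k) (4 / δ ^ 2) (hapos k hk) (haδ k hk).le hF0
      (fun u hu => hF _ _ (hamono 0 k (Nat.zero_le _) hk) hu)
    have h2 : 0 < Real.log (4 / δ ^ 2 / a k) := Real.log_pos (by
      rw [one_lt_div (hapos k hk)]; exact haδ k hk)
    rw [← h] at h1
    have h3 : (4:ℝ≥0∞) / ENNReal.ofReal (0 ^ 2) * ENNReal.ofReal (Real.log (4 / δ ^ 2 / a k)) = ⊤ := by
      simp [ENNReal.div_zero, ENNReal.top_mul, h2]
    rw [h3] at h1
    refine (h1.trans (lintegral_mono_set ?_)).not_gt hfin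
    exact Ioc_subset_Ioc_left (hamono 0 k (Nat.zero_le _) hk)
  have hsum : ∀ k ≤ m, ENNReal.ofReal (4 * c * k) ≤
      ∫⁻ u in Ioc (a 0) (a k), 4 / ENNReal.ofReal (u * F u ^ 2) := by
    intro k
    induction k with
    | zero => simp
    | succ k ih =>
      intro hk
      have hk' : k ≤ m := by omega
      have h1 := integral_lower F (a k) (a (k+1)) (hapos k hk') (hamono _ _ (by omega) hk) hF0
        (fun u hu => hF _ _ (hamono 0 k (Nat.zero_le _) hk') hu)
      have h2 : c * F (a k) ^ 2 ≤ Real.log (a (k+1) / a k) := by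
        have l1 := hLpos k hk'
        have l2 := hLpos (k+1) hk
        have e : a (k+1) / a k = (L (k+1) / L k)⁻¹ ^ 2 := by
          simp only [ha]; field_simp
        rw [e, Real.log_pow, Real.log_inv]
        have h3 : Real.log (L (k+1) / L k) ≤ L (k+1) / L k - 1 := Real.log_le_sub_one_of_pos (by positivity)
        have h4 : L (k+1) / L k ≤ 1 - c * F (a k) ^ 2 / 2 := by
          rw [div_le_iff₀ l1, mul_comm]; exact hL k l1
        push_cast
        linarith
      have h3 : ENNReal.ofReal (4 * c) ≤ 4 / ENNReal.ofReal (F (a k) ^ 2) * ENNReal.ofReal (Real.log (a (k+1) / a k)) := by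
        have f1 : 0 < F (a k) ^ 2 := by have := hFk k hk'; positivity
        have : (4:ℝ≥0∞) / ENNReal.ofReal (F (a k) ^ 2) = ENNReal.ofReal (4 / F (a k) ^ 2) := by
          rw [ENNReal.ofReal_div_of_pos f1]; simp
        rw [this, ← ENNReal.ofReal_mul (by positivity)]
        apply ENNReal.ofReal_le_ofReal
        rw [div_mul_eq_mul_div, le_div_iff₀ f1]
        linarith
      have h4 : Ioc (a 0) (a (k+1)) = Ioc (a 0) (a k) ∪ Ioc (a k) (a (k+1)) :=
        (Ioc_union_Ioc_eq_Ioc (hamono _ _ (Nat.zero_le _) hk') (hamono _ _ (by omega) hk)).symm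
      rw [h4, lintegral_union measurableSet_Ioc (Ioc_disjoint_Ioc_of_le le_rfl)]
      have : ENNReal.ofReal (4 * c * ((k+1 : ℕ) : ℝ)) = ENNReal.ofReal (4 * c * k) + ENNReal.ofReal (4 * c) := by
        rw [← ENNReal.ofReal_add (by positivity) (by positivity)]; push_cast; ring_nf
      rw [this]
      exact add_le_add (ih hk') (h3.trans h1)
  have h4 : Ioc (a 0) (4 / δ ^ 2) = Ioc (a 0) (a m) ∪ Ioc (a m) (4 / δ ^ 2) :=
    (Ioc_union_Ioc_eq_Ioc (hamono _ _ (Nat.zero_le _) le_rfl) (haδ m le_rfl).le).symm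
  have h1 := integral_lower F (a m) (4 / δ ^ 2) (hapos m le_rfl) (haδ m le_rfl).le hF0
      (fun u hu => hF _ _ (hamono 0 m (Nat.zero_le _) le_rfl) hu)
  have h2 : 0 < Real.log (4 / δ ^ 2 / a m) := Real.log_pos (by
      rw [one_lt_div (hapos m le_rfl)]; exact haδ m le_rfl)
  have h3 : 0 < ∫⁻ u in Ioc (a m) (4 / δ ^ 2), 4 / ENNReal.ofReal (u * F u ^ 2) := by
    refine lt_of_lt_of_le ?_ h1
    apply ENNReal.mul_pos
    · simp
    · simpa using h2
  change ∫⁻ u in Ioc (a 0) (4 / δ ^ 2), 4 / ENNReal.ofReal (u * F u ^ 2) ≤ _ at hI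
  rw [h4, lintegral_union measurableSet_Ioc (Ioc_disjoint_Ioc_of_le le_rfl)] at hI
  have h5 := hsum m le_rfl
  have : ENNReal.ofReal (4 * c * m) < ENNReal.ofReal (4 * c * m) + ∫⁻ u in Ioc (a m) (4 / δ ^ 2), 4 / ENNReal.ofReal (u * F u ^ 2) :=
    ENNReal.lt_add_right ENNReal.ofReal_ne_top h3.ne'
  exact absurd (this.trans_le ((add_le_add_left h5 _).trans hI)) (lt_irrefl _)
section Core
variable {V : Type*}

noncomputable def eM (π : V → ℝ≥0∞) (S : Set V) : ℝ≥0∞ := ∑' y, S.indicator π y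

noncomputable def eQ (P : V → V → ℝ≥0∞) (π : V → ℝ≥0∞) (S : Set V) (y : V) : ℝ≥0∞ :=
  ∑' s, S.indicator (fun s => π s * P s y) s

noncomputable def eB (P : V → V → ℝ≥0∞) (π : V → ℝ≥0∞) (S : Set V) : ℝ≥0∞ :=
  ∑' y, Sᶜ.indicator (eQ P π S) y

def eStep (P : V → V → ℝ≥0∞) (π : V → ℝ≥0∞) (S : Set V) (u : ℝ) : Set V :=
  {y | ENNReal.ofReal u * π y ≤ eQ P π S y}

noncomputable def ePn (P : V → V → ℝ≥0∞) : ℕ → V → V → ℝ≥0∞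
  | 0 => fun x y => if x = y then 1 else 0
  | n + 1 => fun x y => ∑' z, ePn P n x z * P z y

noncomputable def eμ (P : V → V → ℝ≥0∞) (π : V → ℝ≥0∞) (x : V) : ℕ → Measure (Set V)
  | 0 => Measure.dirac {x}
  | n + 1 => ((eμ P π x n).prod (volume.restrict (Ioc (0:ℝ) 1))).map
      (fun q => eStep P π q.1 q.2)

structure Chain (P : V → V → ℝ≥0∞) (π : V → ℝ≥0∞) (γ : ℝ) : Prop where
  pi0 : ∀ x, π x ≠ 0
  pitop : ∀ x, π x ≠ ⊤
  row : ∀ x, ∑' y, P x y = 1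
  stat : ∀ y, ∑' x, π x * P x y = π y
  g0 : 0 < γ
  g1 : γ ≤ 1 / 2
  lazy : ∀ x, ENNReal.ofReal γ ≤ P x x

variable {P : V → V → ℝ≥0∞} {π : V → ℝ≥0∞} {γ : ℝ}

theorem meas_ind (f : V → ℝ≥0∞) (y : V) : Measurable fun S : Set V => S.indicator f y := by
  have : (fun S : Set V => S.indicator f y) = fun S => if y ∈ S then f y else 0 := by
    ext S; simp [indicator_apply]
  rw [this]
  exact Measurable.ite (measurableSet_setOfPred.2 (measurable_set_mem y)) measurable_const measurable_const

theorem meas_eM [Countable V] : Measurable (eM π) :=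
  Measurable.tsum fun y => meas_ind π y

theorem meas_eQ [Countable V] (y : V) : Measurable fun S => eQ P π S y :=
  Measurable.tsum fun s => meas_ind (fun s => π s * P s y) s

theorem meas_step [Countable V] : Measurable fun q : Set V × ℝ => eStep P π q.1 q.2 := by
  rw [measurable_set_iff]
  intro y
  apply measurableSet_setOfPred.1
  have h1 : Measurable fun q : Set V × ℝ => eQ P π q.1 y := (meas_eQ y).comp measurable_fst
  have h2 : Measurable fun q : Set V × ℝ => ENNReal.ofReal q.2 * π y := by fun_prop
  exact measurableSet_le h2 h1

theorem meas_step' [Countable V] (S : Set V) : Measurable fun u : ℝ => eStep P π S u :=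
  meas_step.comp measurable_prodMk_left

theorem eμ_prob [Countable V] (x : V) (n : ℕ) : IsProbabilityMeasure (eμ P π x n) := by
  induction n with
  | zero => exact Measure.dirac.isProbabilityMeasure
  | succ n ih =>
    have : IsProbabilityMeasure (volume.restrict (Ioc (0:ℝ) 1)) := ⟨by simp⟩
    exact Measure.isProbabilityMeasure_map meas_step.aemeasurable

theorem lint_succ [Countable V] (x : V) (n : ℕ) (F : Set V → ℝ≥0∞) (hF : Measurable F) :
    ∫⁻ S, F S ∂(eμ P π x (n+1)) = ∫⁻ S, (∫⁻ u in Ioc (0:ℝ) 1, F (eStep P π S u)) ∂(eμ P π x n) := by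
  have := eμ_prob (P := P) (π := π) x n
  rw [eμ, lintegral_map hF meas_step, lintegral_prod]
  exact (hF.comp meas_step).aemeasurable

namespace Chain

theorem Q_le (h : Chain P π γ) (S : Set V) (y : V) : eQ P π S y ≤ π y := by
  rw [← h.stat y]
  exact ENNReal.tsum_le_tsum fun s => indicator_le_self' (fun _ _ => zero_le) s

theorem sum_Q (h : Chain P π γ) (S : Set V) : ∑' y, eQ P π S y = eM π S := by
  unfold eQ eM
  rw [ENNReal.tsum_comm]
  congr 1; ext s
  by_cases hs : s ∈ S
  · simp [hs, ENNReal.tsum_mul_left, h.row]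
  · simp [hs]

theorem int_ind (h : Chain P π γ) (S : Set V) (y : V) (b : ℝ) :
    ∫⁻ u in Ioc 0 b, (eStep P π S u).indicator π y = min (ENNReal.ofReal b * π y) (eQ P π S y) := by
  have hq := h.Q_le S y
  have hqt : eQ P π S y ≠ ⊤ := ne_top_of_le_ne_top (h.pitop y) hq
  set q := eQ P π S y with hqd
  set t := (q / π y).toReal with ht
  have hqp : q / π y ≠ ⊤ := ENNReal.div_ne_top hqt (h.pi0 y)
  have h1 : ∀ u ∈ Ioc 0 b, (eStep P π S u).indicator π y = (Iic t).indicator (fun _ => π y) u := by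
    intro u hu
    have : y ∈ eStep P π S u ↔ u ∈ Iic t := by
      change ENNReal.ofReal u * π y ≤ q ↔ u ≤ t
      rw [← ENNReal.le_div_iff_mul_le (Or.inl (h.pi0 y)) (Or.inl (h.pitop y)),
        ENNReal.ofReal_le_iff_le_toReal hqp]
    by_cases hy : y ∈ eStep P π S u
    · rw [indicator_of_mem hy, indicator_of_mem (this.1 hy)]
    · rw [indicator_of_notMem hy, indicator_of_notMem (fun h' => hy (this.2 h'))]
  rw [setLIntegral_congr_fun measurableSet_Ioc h1, lintegral_indicator measurableSet_Iic,
    setLIntegral_const, Measure.restrict_apply measurableSet_Iic]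
  have h2 : Iic t ∩ Ioc 0 b = Ioc 0 (min b t) := by
    ext u; simp only [mem_inter_iff, mem_Iic, mem_Ioc, le_min_iff]; tauto
  rw [h2, Real.volume_Ioc, sub_zero, ENNReal.ofReal_min, ht, ENNReal.ofReal_toReal hqp,
    mul_comm, min_mul, ENNReal.div_mul_cancel (h.pi0 y) (h.pitop y)]

theorem int_M [Countable V] (h : Chain P π γ) (S : Set V) (b : ℝ) :
    ∫⁻ u in Ioc 0 b, eM π (eStep P π S u) = ∑' y, min (ENNReal.ofReal b * π y) (eQ P π S y) := by
  unfold eM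
  rw [lintegral_tsum]
  · simp_rw [h.int_ind]
  · intro y
    exact ((meas_ind π y).comp (meas_step' S)).aemeasurable

theorem int_M_one [Countable V] (h : Chain P π γ) (S : Set V) :
    ∫⁻ u in Ioc (0:ℝ) 1, eM π (eStep P π S u) = eM π S := by
  rw [h.int_M, ← h.sum_Q]
  congr 1; ext y
  simp [h.Q_le S y]

theorem jensen (w : ℝ → ℝ≥0∞) (hw : Measurable w) (a b : ℝ) :
    ∫⁻ u in Ioc a b, w u ^ (1/2:ℝ) ≤ (ENNReal.ofReal (b - a) * ∫⁻ u in Ioc a b, w u) ^ (1/2:ℝ) := by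
  have := ENNReal.lintegral_mul_le_Lp_mul_Lq (volume.restrict (Ioc a b))
    Real.HolderConjugate.two_two (f := fun u => w u ^ (1/2:ℝ)) (g := fun _ => 1)
    (by fun_prop) (by fun_prop)
  simp only [Pi.mul_apply, mul_one, ← ENNReal.rpow_mul] at this
  norm_num at this
  rw [ENNReal.mul_rpow_of_nonneg _ _ (by norm_num), mul_comm]
  norm_num
  exact this

theorem int_low [Countable V] (h : Chain P π γ) (S : Set V) :
    ENNReal.ofReal γ * eM π S + ENNReal.ofReal (γ / (1 - γ)) * eB P π S ≤
      ∫⁻ u in Ioc 0 γ, eM π (eStep P π S u) := by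
  have g0 := h.g0
  have g1 := h.g1
  rw [h.int_M, eM, eB, ← ENNReal.tsum_mul_left, ← ENNReal.tsum_mul_left, ← ENNReal.tsum_add]
  refine ENNReal.tsum_le_tsum fun y => ?_
  by_cases hy : y ∈ S
  · simp only [indicator_of_mem hy, indicator_of_notMem (show y ∉ Sᶜ from fun h => h hy), mul_zero,
      add_zero]
    refine le_min le_rfl ?_
    have : S.indicator (fun s => π s * P s y) y ≤ eQ P π S y := ENNReal.le_tsum y
    rw [indicator_of_mem hy] at this
    refine le_trans ?_ this
    rw [mul_comm]
    gcongr
    exact h.lazy y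
  · simp only [indicator_of_notMem hy, indicator_of_mem (show y ∈ Sᶜ from hy), mul_zero, zero_add]
    have hle : eQ P π S y ≤ ENNReal.ofReal (1 - γ) * π y := by
      have h1 : eQ P π S y + π y * P y y ≤ π y := by
        refine le_trans ?_ (h.stat y).le
        rw [eQ, ← tsum_ite_eq y (fun s => π s * P s y), ← ENNReal.tsum_add]
        refine ENNReal.tsum_le_tsum fun s => ?_
        by_cases hs : s = y
        · subst hs; simp [hy]
        · simp only [hs, if_false, add_zero]
          exact indicator_le_self' (fun _ _ => zero_le) s
      have h2 : eQ P π S y + π y * ENNReal.ofReal γ ≤ π y := le_trans (by gcongr; exact h.lazy y) h1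
      have h3 : π y = ENNReal.ofReal (1 - γ) * π y + π y * ENNReal.ofReal γ := by
        rw [mul_comm (π y), ← add_mul, ← ENNReal.ofReal_add (by linarith) g0.le]; simp
      rw [h3] at h2
      exact (ENNReal.add_le_add_iff_right (ENNReal.mul_ne_top (h.pitop y) ENNReal.ofReal_ne_top)).1 (by
        rw [← h3] at h2 ⊢; exact h2)
    refine le_min ?_ ?_
    · calc _ ≤ ENNReal.ofReal (γ / (1 - γ)) * (ENNReal.ofReal (1 - γ) * π y) := by gcongr
        _ = _ := by
          rw [← mul_assoc, ← ENNReal.ofReal_mul (by apply div_nonneg <;> linarith),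
            div_mul_cancel₀ _ (by linarith)]
    · calc _ ≤ 1 * eQ P π S y := by
            gcongr
            rw [ENNReal.ofReal_le_one, div_le_one (by linarith)]; linarith
        _ = _ := one_mul _

theorem one_step [Countable V] (h : Chain P π γ) (S : Set V) (hS0 : eM π S ≠ 0) (hS : eM π S ≠ ⊤)
    (φ : ℝ) (hφ0 : 0 ≤ φ) (hφ : ENNReal.ofReal φ * eM π S ≤ eB P π S) :
    (∫⁻ u in Ioc (0:ℝ) 1, eM π (eStep P π S u) ^ (1/2:ℝ)) +
      ENNReal.ofReal (γ ^ 2 / (2 * (1 - γ) ^ 2) * φ ^ 2) * eM π S ^ (1/2:ℝ) ≤ eM π S ^ (1/2:ℝ) := by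
  have g0 := h.g0
  have g1 := h.g1
  have g2 : 0 < 1 - γ := by linarith
  have hmeas : Measurable fun u => eM π (eStep P π S u) := meas_eM.comp (meas_step' S)
  have hsplit : Ioc (0:ℝ) 1 = Ioc 0 γ ∪ Ioc γ 1 := (Ioc_union_Ioc_eq_Ioc g0.le (by linarith)).symm
  have hd : Disjoint (Ioc 0 γ) (Ioc γ 1) := Ioc_disjoint_Ioc_of_le le_rfl
  have hlow := h.int_low S
  have htot := h.int_M_one S
  rw [hsplit, lintegral_union measurableSet_Ioc hd] at htot
  rw [hsplit, lintegral_union measurableSet_Ioc hd]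
  have j1 := jensen _ hmeas 0 γ
  have j2 := jensen _ hmeas γ 1
  set A := ∫⁻ u in Ioc 0 γ, eM π (eStep P π S u)
  set B := ∫⁻ u in Ioc γ 1, eM π (eStep P π S u)
  set M := eM π S
  have hA : A ≠ ⊤ := ne_top_of_le_ne_top hS (htot ▸ le_self_add)
  have hB : B ≠ ⊤ := ne_top_of_le_ne_top hS (htot ▸ le_add_self)
  obtain ⟨m, hm0, hm⟩ : ∃ m : ℝ, 0 < m ∧ M = ENNReal.ofReal m :=
    ⟨M.toReal, ENNReal.toReal_pos hS0 hS, (ENNReal.ofReal_toReal hS).symm⟩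
  obtain ⟨α, hα0, hα⟩ : ∃ m : ℝ, 0 ≤ m ∧ A = ENNReal.ofReal m :=
    ⟨A.toReal, ENNReal.toReal_nonneg, (ENNReal.ofReal_toReal hA).symm⟩
  obtain ⟨β, hβ0, hβ⟩ : ∃ m : ℝ, 0 ≤ m ∧ B = ENNReal.ofReal m :=
    ⟨B.toReal, ENNReal.toReal_nonneg, (ENNReal.ofReal_toReal hB).symm⟩
  have hlow' : γ * m + γ / (1 - γ) * (φ * m) ≤ α := by
    have : ENNReal.ofReal (γ * m + γ / (1 - γ) * (φ * m)) ≤ ENNReal.ofReal α := by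
      rw [← hα, ENNReal.ofReal_add (by positivity) (by positivity), ENNReal.ofReal_mul g0.le,
        ENNReal.ofReal_mul (by positivity), ENNReal.ofReal_mul hφ0, ← hm]
      refine le_trans ?_ hlow
      gcongr
    exact (ENNReal.ofReal_le_ofReal_iff hα0).1 this
  have htot' : α + β = m := by
    rw [hα, hβ, hm, ← ENNReal.ofReal_add hα0 hβ0] at htot
    exact (ENNReal.ofReal_eq_ofReal_iff (by positivity) hm0.le).1 htot
  have hr : ∀ t : ℝ, 0 ≤ t → ENNReal.ofReal t ^ (1/2:ℝ) = ENNReal.ofReal (√t) := by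
    intro t ht
    rw [ENNReal.ofReal_rpow_of_nonneg ht (by norm_num), Real.sqrt_eq_rpow]
  rw [hα, sub_zero, ← ENNReal.ofReal_mul g0.le, hr _ (by positivity)] at j1
  rw [hβ, ← ENNReal.ofReal_mul g2.le, hr _ (by positivity)] at j2
  rw [hm, hr _ hm0.le]
  refine (add_le_add_left (add_le_add j1 j2) _).trans ?_
  rw [← ENNReal.ofReal_mul (by positivity), ← ENNReal.ofReal_add (by positivity) (by positivity),
    ← ENNReal.ofReal_add (by positivity) (by positivity)]
  apply ENNReal.ofReal_le_ofReal
  set a := α / (γ * m) - 1 with ha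
  have hαa : α = γ * m * (1 + a) := by rw [ha]; field_simp; ring
  have ha1 : φ / (1 - γ) ≤ a := by
    have e : γ * m + γ / (1 - γ) * (φ * m) = γ * m * (1 + φ / (1 - γ)) := by field_simp
    rw [e, hαa] at hlow'
    have := le_of_mul_le_mul_left hlow' (by positivity)
    linarith
  have ha0 : 0 ≤ a := le_trans (by positivity) ha1
  have hβa : β = m * (1 - γ - γ * a) := by
    have : β = m - α := by linarith
    rw [this, hαa]; ring
  have ha2 : γ * a ≤ 1 - γ := by
    rw [hβa] at hβ0
    have := nonneg_of_mul_nonneg_right hβ0 hm0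
    linarith
  have key := real_key γ a g0 g1 ha0 ha2
  have e1 : √(γ * α) = √m * (γ * √(1 + a)) := by
    rw [hαa, show γ * (γ * m * (1 + a)) = γ ^ 2 * (m * (1 + a)) by ring,
      Real.sqrt_mul (by positivity), Real.sqrt_sq g0.le, Real.sqrt_mul hm0.le]; ring
  have e2 : √((1 - γ) * β) = √m * ((1 - γ) * √(1 - γ * a / (1 - γ))) := by
    rw [hβa, show (1 - γ) * (m * (1 - γ - γ * a)) = (1 - γ) ^ 2 * (m * (1 - γ * a / (1 - γ))) by
        field_simp,
      Real.sqrt_mul (by positivity), Real.sqrt_sq g2.le, Real.sqrt_mul hm0.le]; ring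
  rw [e1, e2]
  have e3 : γ ^ 2 / (2 * (1 - γ) ^ 2) * φ ^ 2 ≤ γ ^ 2 * a ^ 2 / 2 := by
    have : γ ^ 2 / (2 * (1 - γ) ^ 2) * φ ^ 2 = γ ^ 2 * (φ / (1 - γ)) ^ 2 / 2 := by field_simp
    rw [this]; gcongr
  have : 0 ≤ √m := Real.sqrt_nonneg m
  nlinarith

end Chain
end Core
section Core2
variable {V : Type*} {P : V → V → ℝ≥0∞} {π : V → ℝ≥0∞} {γ : ℝ}
namespace Chain

theorem eM_singleton (x : V) : eM π {x} = π x := by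
  unfold eM
  rw [tsum_eq_single x]
  · simp
  · intro y hy; simp [hy]

theorem mem_law [Countable V] (h : Chain P π γ) (x y : V) (n : ℕ) :
    ∫⁻ S, S.indicator π y ∂(eμ P π x n) = π x * ePn P n x y := by
  induction n generalizing y with
  | zero =>
    rw [eμ, lintegral_dirac' _ (meas_ind π y), ePn]
    by_cases hxy : x = y
    · subst hxy; simp
    · simp [hxy, Ne.symm hxy]
  | succ n ih =>
    rw [lint_succ x n _ (meas_ind π y)]
    have : ∀ S : Set V, ∫⁻ u in Ioc (0:ℝ) 1, (eStep P π S u).indicator π y = eQ P π S y := by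
      intro S; rw [h.int_ind]; simp [h.Q_le S y]
    simp_rw [this]
    unfold eQ
    rw [lintegral_tsum (fun s => (meas_ind _ s).aemeasurable), ePn, ← ENNReal.tsum_mul_left]
    congr 1; ext s
    rw [← mul_assoc, ← ih s, ← lintegral_mul_const _ (meas_ind π s)]
    congr 1; ext S
    by_cases hs : s ∈ S <;> simp [hs]

theorem int_eM [Countable V] (h : Chain P π γ) (x : V) (n : ℕ) :
    ∫⁻ S, eM π S ∂(eμ P π x n) = π x := by
  induction n with
  | zero => rw [eμ, lintegral_dirac' _ meas_eM, eM_singleton]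
  | succ n ih => 
    rw [lint_succ x n _ meas_eM]
    simp_rw [h.int_M_one]
    exact ih

noncomputable def eH (P : V → V → ℝ≥0∞) (π : V → ℝ≥0∞) (x : V) (n : ℕ) : ℝ≥0∞ :=
  ∫⁻ S, eM π S ^ (1/2:ℝ) ∂(eμ P π x n)

theorem half_mul_half (t : ℝ≥0∞) : t ^ (1/2:ℝ) * t ^ (1/2:ℝ) = t := by
  rw [← ENNReal.rpow_add_of_nonneg _ _ (by norm_num) (by norm_num)]; norm_num

theorem l2_bound [Countable V] (h : Chain P π γ) (x : V) (n : ℕ) :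
    ∑' y, (π x * ePn P n x y) ^ 2 / π y ≤ eH P π x n ^ 2 := by
  simp_rw [← h.mem_law x _ n]
  set μ := eμ P π x n
  have m1 : Measurable fun S => eM π S ^ (1/2:ℝ) := meas_eM.pow_const _
  have e1 : ∀ y, (∫⁻ S, S.indicator π y ∂μ) ^ 2 / π y =
      ∫⁻ S, (∫⁻ S', S.indicator π y * S'.indicator π y / π y ∂μ) ∂μ := by
    intro y
    have : ∀ S : Set V, (∫⁻ S', S.indicator π y * S'.indicator π y / π y ∂μ) =
        S.indicator π y * ((∫⁻ S', S'.indicator π y ∂μ) / π y) := by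
      intro S
      simp_rw [div_eq_mul_inv, mul_assoc]
      rw [lintegral_const_mul _ ((meas_ind π y).mul_const _), lintegral_mul_const _ (meas_ind π y)]
    simp_rw [this]
    rw [lintegral_mul_const _ (meas_ind π y), sq, mul_div_assoc]
  simp_rw [e1]
  have m2 : ∀ y : V, ∀ S : Set V, Measurable fun S' : Set V => S.indicator π y * S'.indicator π y / π y := by
    intro y S
    exact ((meas_ind π y).const_mul _).div_const _
  have hprob : IsProbabilityMeasure μ := eμ_prob x n
  rw [← lintegral_tsum]
  swap
  · intro y
    have : Measurable fun q : Set V × Set V => q.1.indicator π y * q.2.indicator π y / π y :=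
      ((meas_ind π y).comp measurable_fst |>.mul ((meas_ind π y).comp measurable_snd)).div_const _
    exact this.lintegral_prod_right'.aemeasurable
  have e2 : eH P π x n ^ 2 = ∫⁻ S, (∫⁻ S', eM π S ^ (1/2:ℝ) * eM π S' ^ (1/2:ℝ) ∂μ) ∂μ := by
    simp_rw [lintegral_const_mul _ m1]
    rw [lintegral_mul_const _ m1, sq]; rfl
  rw [e2]
  refine lintegral_mono fun S => ?_
  rw [← lintegral_tsum (fun y => (m2 y S).aemeasurable)]
  refine lintegral_mono fun S' => ?_
  have hS : ∑' y, S.indicator π y * S'.indicator π y / π y ≤ eM π S := by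
    refine ENNReal.tsum_le_tsum fun y => ?_
    rw [mul_div_assoc]
    refine mul_le_of_le_one_right' ?_
    refine ENNReal.div_le_of_le_mul ?_
    rw [one_mul]; exact indicator_le_self' (fun _ _ => zero_le) y
  have hS' : ∑' y, S.indicator π y * S'.indicator π y / π y ≤ eM π S' := by
    refine ENNReal.tsum_le_tsum fun y => ?_
    rw [mul_comm, mul_div_assoc]
    refine mul_le_of_le_one_right' ?_
    refine ENNReal.div_le_of_le_mul ?_
    rw [one_mul]; exact indicator_le_self' (fun _ _ => zero_le) y
  calc _ = (∑' y, S.indicator π y * S'.indicator π y / π y) ^ (1/2:ℝ) *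
        (∑' y, S.indicator π y * S'.indicator π y / π y) ^ (1/2:ℝ) := (half_mul_half _).symm
    _ ≤ _ := by gcongr

theorem step_le [Countable V] (h : Chain P π γ) (S : Set V) :
    ∫⁻ u in Ioc (0:ℝ) 1, eM π (eStep P π S u) ^ (1/2:ℝ) ≤ eM π S ^ (1/2:ℝ) := by
  have := jensen _ ((meas_eM (π := π)).comp (meas_step' (P := P) (π := π) S)) 0 1
  simp only [Function.comp_apply, h.int_M_one] at this
  simpa using this

theorem eH_succ_le [Countable V] (h : Chain P π γ) (x : V) (n : ℕ) :
    eH P π x (n+1) ≤ eH P π x n := by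
  unfold eH
  rw [lint_succ x n _ (meas_eM.pow_const _)]
  exact lintegral_mono fun S => h.step_le S

theorem eH_zero [Countable V] (x : V) : eH P π x 0 = π x ^ (1/2:ℝ) := by
  unfold eH
  rw [eμ, lintegral_dirac' _ (meas_eM.pow_const _), eM_singleton]

theorem eH_ne_top [Countable V] (h : Chain P π γ) (x : V) (n : ℕ) : eH P π x n ≠ ⊤ := by
  induction n with
  | zero => 
    rw [eH_zero]
    exact ENNReal.rpow_ne_top_of_nonneg (by norm_num) (h.pitop x)
  | succ n ih => exact ne_top_of_le_ne_top ih (h.eH_succ_le x n)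

theorem eH_step [Countable V] (h : Chain P π γ) (x : V) (n : ℕ) (r φ : ℝ) (hφ0 : 0 ≤ φ)
    (hr0 : 0 ≤ r)
    (hr : eH P π x n * ENNReal.ofReal r ^ (1/2:ℝ) = 2 * π x)
    (hφ : ∀ S, eM π S ≠ 0 → eM π S ≤ ENNReal.ofReal r → ENNReal.ofReal φ * eM π S ≤ eB P π S) :
    eH P π x (n+1) + ENNReal.ofReal (γ ^ 2 / (2 * (1 - γ) ^ 2) * φ ^ 2) * (eH P π x n / 2) ≤
      eH P π x n := by
  have m1 : Measurable fun S => eM π S ^ (1/2:ℝ) := meas_eM.pow_const _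
  set A : Set (Set V) := {S | eM π S ≤ ENNReal.ofReal r} with hAdef
  have hA : MeasurableSet A := measurableSet_le meas_eM measurable_const
  set μ := eμ P π x n with hμ
  set k := ENNReal.ofReal (γ ^ 2 / (2 * (1 - γ) ^ 2) * φ ^ 2)
  have hHt := h.eH_ne_top x n
  have hsum : ∫⁻ S in A, eM π S ^ (1/2:ℝ) ∂μ + ∫⁻ S in Aᶜ, eM π S ^ (1/2:ℝ) ∂μ = eH P π x n :=
    lintegral_add_compl _ hA
  have hc : (∫⁻ S in Aᶜ, eM π S ^ (1/2:ℝ) ∂μ) * ENNReal.ofReal r ^ (1/2:ℝ) ≤ π x := by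
    rw [← lintegral_mul_const _ m1]
    refine le_trans ?_ (h.int_eM x n).le
    refine le_trans ?_ (setLIntegral_le_lintegral Aᶜ _)
    refine setLIntegral_mono' hA.compl fun S hS => ?_
    have : ENNReal.ofReal r ≤ eM π S := (not_le.1 (show ¬ eM π S ≤ ENNReal.ofReal r from hS)).le
    calc _ ≤ eM π S ^ (1/2:ℝ) * eM π S ^ (1/2:ℝ) := by gcongr
      _ = _ := half_mul_half _
  have hhalf : eH P π x n / 2 ≤ ∫⁻ S in A, eM π S ^ (1/2:ℝ) ∂μ := by
    set D := ∫⁻ S in Aᶜ, eM π S ^ (1/2:ℝ) ∂μ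
    have hDle : D ≤ eH P π x n / 2 := by
      set w := ENNReal.ofReal r ^ (1/2:ℝ)
      have hw : w ≠ ⊤ := ENNReal.rpow_ne_top_of_nonneg (by norm_num) ENNReal.ofReal_ne_top
      have hw0 : w ≠ 0 := by
        intro h0; rw [h0, mul_zero] at hr
        exact (mul_ne_zero two_ne_zero (h.pi0 x)) hr.symm
      rw [ENNReal.le_div_iff_mul_le (by simp) (by simp)]
      refine (ENNReal.mul_le_mul_iff_left hw0 hw).1 ?_
      rw [hr]
      calc D * 2 * w = 2 * (D * w) := by ring
        _ ≤ _ := by gcongr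
    have : eH P π x n / 2 + eH P π x n / 2 ≤ ∫⁻ S in A, eM π S ^ (1/2:ℝ) ∂μ + eH P π x n / 2 := by
      rw [ENNReal.add_halves, ← hsum]
      gcongr
      rw [hsum]; exact hDle
    exact (ENNReal.add_le_add_iff_right (ENNReal.div_ne_top hHt (by simp))).1 this
  calc _ ≤ eH P π x (n+1) + k * ∫⁻ S in A, eM π S ^ (1/2:ℝ) ∂μ := by gcongr
    _ = ∫⁻ S, (∫⁻ u in Ioc (0:ℝ) 1, eM π (eStep P π S u) ^ (1/2:ℝ)) ∂μ +
        ∫⁻ S, A.indicator (fun S => k * eM π S ^ (1/2:ℝ)) S ∂μ := by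
      congr 1
      · unfold eH; rw [lint_succ x n _ m1]
      · rw [lintegral_indicator hA, lintegral_const_mul _ m1]
    _ = ∫⁻ S, ((∫⁻ u in Ioc (0:ℝ) 1, eM π (eStep P π S u) ^ (1/2:ℝ)) +
        A.indicator (fun S => k * eM π S ^ (1/2:ℝ)) S) ∂μ := by
      rw [lintegral_add_right]
      exact (m1.const_mul k).indicator hA
    _ ≤ _ := by
      refine lintegral_mono fun S => ?_
      by_cases hS : S ∈ A
      · rw [indicator_of_mem hS]
        by_cases h0 : eM π S = 0
        · have := h.step_le S
          simp only [h0] at this ⊢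
          simpa using this
        · exact h.one_step S h0 (ne_top_of_le_ne_top ENNReal.ofReal_ne_top hS) φ hφ0 (hφ S h0 hS)
      · rw [indicator_of_notMem hS, add_zero]
        exact h.step_le S

theorem core [Countable V] (h : Chain P π γ) (x : V) (Φ : ℝ → ℝ) (hΦ0 : ∀ u, 0 ≤ Φ u)
    (hΦm : ∀ r r', (π x).toReal ≤ r → r ≤ r' → Φ r' ≤ Φ r)
    (hΦ : ∀ r S, eM π S ≠ 0 → eM π S ≤ ENNReal.ofReal r → ENNReal.ofReal (Φ r) * eM π S ≤ eB P π S)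
    (ε : ℝ) (hε : 0 < ε) (m : ℕ)
    (hI : ∫⁻ u in Ioc (4 * (π x).toReal) (4 / ε), 4 / ENNReal.ofReal (u * Φ u ^ 2) ≤
      ENNReal.ofReal (4 * (γ ^ 2 / (2 * (1 - γ) ^ 2)) * m)) :
    ∑' y, ePn P m x y ^ 2 / π y ≤ ENNReal.ofReal ε := by
  have g0 := h.g0
  have g1 := h.g1
  have g2 : 0 < 1 - γ := by linarith
  set p := (π x).toReal with hp
  have hp0 : 0 < p := ENNReal.toReal_pos (h.pi0 x) (h.pitop x)
  have hpx : π x = ENNReal.ofReal p := (ENNReal.ofReal_toReal (h.pitop x)).symm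
  set H : ℕ → ℝ := fun k => (eH P π x k).toReal with hH
  have hHe : ∀ k, eH P π x k = ENNReal.ofReal (H k) := fun k =>
    (ENNReal.ofReal_toReal (h.eH_ne_top x k)).symm
  have hHn : ∀ k, 0 ≤ H k := fun k => ENNReal.toReal_nonneg
  have hr : ∀ t : ℝ, 0 ≤ t → ENNReal.ofReal t ^ (1/2:ℝ) = ENNReal.ofReal (√t) := by
    intro t ht
    rw [ENNReal.ofReal_rpow_of_nonneg ht (by norm_num), Real.sqrt_eq_rpow]
  have hH0 : H 0 = √p := by
    simp only [hH]; rw [eH_zero, hpx, hr _ hp0.le, ENNReal.toReal_ofReal (Real.sqrt_nonneg _)]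
  have hsp : 0 < √p := Real.sqrt_pos.2 hp0
  have hssp : √p ^ 2 = p := Real.sq_sqrt hp0.le
  have hL0 : 4 / (H 0 / p) ^ 2 = 4 * p := by
    rw [hH0, div_pow, hssp]; field_simp
  have key : H m / p ≤ √ε := by
    refine recursion Φ hΦ0 (γ ^ 2 / (2 * (1 - γ) ^ 2)) (by positivity) (fun k => H k / p) (√ε)
      (Real.sqrt_pos.2 hε) ?_ m ?_ ?_ ?_
    · intro r r' h1 h2
      refine hΦm r r' ?_ h2
      simp only [hL0] at h1
      linarith
    · intro k
      gcongr
      exact ENNReal.toReal_mono (h.eH_ne_top x k) (h.eH_succ_le x k)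
    · intro k hk
      have hHk : 0 < H k := by
        by_contra hc
        have : H k / p ≤ 0 := div_nonpos_of_nonpos_of_nonneg (not_lt.1 hc) hp0.le
        linarith
      set r := 4 / (H k / p) ^ 2 with hrd
      have hrr : r = (2 * p / H k) ^ 2 := by rw [hrd]; field_simp; norm_num
      have := h.eH_step x k r (Φ r) (hΦ0 r) (by positivity) (by
        rw [hr _ (by positivity), hrr, Real.sqrt_sq (by positivity), hHe, hpx,
          ← ENNReal.ofReal_mul hHk.le]
        have : H k * (2 * p / H k) = 2 * p := by field_simp
        rw [this, ENNReal.ofReal_mul (by norm_num)]; simp) (hΦ r)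
      have e2 : ENNReal.ofReal (H k) / 2 = ENNReal.ofReal (H k / 2) := by
        rw [ENNReal.ofReal_div_of_pos (by norm_num)]; simp
      rw [hHe, hHe, e2, ← ENNReal.ofReal_mul (by positivity),
        ← ENNReal.ofReal_add (hHn _) (by positivity), ENNReal.ofReal_le_ofReal_iff (hHn k)] at this
      rw [div_mul_eq_mul_div]
      gcongr
      linarith
    · simp only [hL0]
      rw [Real.sq_sqrt hε.le]
      exact hI
  have hl2 := h.l2_bound x m
  have e1 : ∑' y, (π x * ePn P m x y) ^ 2 / π y = π x ^ 2 * ∑' y, ePn P m x y ^ 2 / π y := by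
    rw [← ENNReal.tsum_mul_left]
    congr 1; ext y
    rw [mul_pow, mul_div_assoc]
  rw [e1] at hl2
  have hx2 : π x ^ 2 ≠ 0 := pow_ne_zero 2 (h.pi0 x)
  refine (ENNReal.mul_le_mul_iff_right hx2 (ENNReal.pow_ne_top (h.pitop x))).1 (hl2.trans ?_)
  rw [hHe, hpx, ← ENNReal.ofReal_pow (hHn m), ← ENNReal.ofReal_pow hp0.le, ← ENNReal.ofReal_mul (by positivity)]
  apply ENNReal.ofReal_le_ofReal
  rw [div_le_iff₀ hp0] at key
  calc H m ^ 2 ≤ (√ε * p) ^ 2 := by have := hHn m; gcongr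
    _ = _ := by rw [mul_pow, Real.sq_sqrt hε.le]; ring

end Chain
end Core2
section Rev
variable {V : Type*} {P : V → V → ℝ≥0∞} {π : V → ℝ≥0∞} {γ : ℝ}
namespace Chain

noncomputable def rev (P : V → V → ℝ≥0∞) (π : V → ℝ≥0∞) (x y : V) : ℝ≥0∞ := π y * P y x / π x

theorem pi_rev (h : Chain P π γ) (x y : V) : π x * rev P π x y = π y * P y x :=
  ENNReal.mul_div_cancel (h.pi0 x) (h.pitop x)

theorem chain_rev (h : Chain P π γ) : Chain (rev P π) π γ where
  pi0 := h.pi0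
  pitop := h.pitop
  row x := by
    simp only [rev, div_eq_mul_inv]
    rw [ENNReal.tsum_mul_right, h.stat, ENNReal.mul_inv_cancel (h.pi0 x) (h.pitop x)]
  stat y := by
    simp_rw [h.pi_rev]
    rw [ENNReal.tsum_mul_left, h.row, mul_one]
  g0 := h.g0
  g1 := h.g1
  lazy x := by
    have : rev P π x x = P x x := by
      rw [rev, mul_comm, ENNReal.mul_div_cancel_right (h.pi0 x) (h.pitop x)]
    rw [this]; exact h.lazy x

theorem eB_add (h : Chain P π γ) (S : Set V) :
    (∑' y, S.indicator (eQ P π S) y) + eB P π S = eM π S := by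
  rw [eB, ← ENNReal.tsum_add, ← h.sum_Q]
  congr 1; ext y
  exact congrFun (indicator_self_add_compl S (eQ P π S)) y

theorem eB_rev (h : Chain P π γ) (S : Set V) (hS : eM π S ≠ ⊤) :
    eB (rev P π) π S = eB P π S := by
  have h1 := h.eB_add S
  have h2 := h.chain_rev.eB_add S
  have e : (∑' y, S.indicator (eQ (rev P π) π S) y) = ∑' y, S.indicator (eQ P π S) y := by
    have a1 : ∀ R : V → V → ℝ≥0∞, (∑' y, S.indicator (eQ R π S) y) =
        ∑' y, ∑' s, (if y ∈ S then (if s ∈ S then π s * R s y else 0) else 0) := by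
      intro R
      congr 1; ext y
      by_cases hy : y ∈ S
      · simp [hy, eQ, indicator_apply]
      · simp [hy]
    rw [a1, a1, ENNReal.tsum_comm]
    congr 1; ext y; congr 1; ext s
    rw [h.pi_rev]
    split_ifs <;> rfl
  rw [e] at h2
  have ht : (∑' y, S.indicator (eQ P π S) y) ≠ ⊤ := ne_top_of_le_ne_top hS (h1 ▸ le_self_add)
  exact (ENNReal.add_right_inj ht).1 (h2.trans h1.symm)

theorem ck (m n : ℕ) (x y : V) : ePn P (m + n) x y = ∑' z, ePn P m x z * ePn P n z y := by
  induction n generalizing y with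
  | zero =>
    rw [tsum_eq_single y]
    · simp [ePn]
    · intro z hz; simp [ePn, hz]
  | succ n ih =>
    rw [← add_assoc]
    simp only [ePn]
    simp_rw [ih, ← ENNReal.tsum_mul_left, ← ENNReal.tsum_mul_right]
    rw [ENNReal.tsum_comm]
    simp_rw [mul_assoc]

theorem ePn_one (x y : V) : ePn P 1 x y = P x y := by
  simp only [ePn]
  rw [tsum_eq_single x]
  · simp
  · intro z hz; simp [Ne.symm hz]

theorem ePn_rev (h : Chain P π γ) (n : ℕ) (x y : V) :
    π x * ePn (rev P π) n x y = π y * ePn P n y x := by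
  induction n generalizing y with
  | zero =>
    simp only [ePn]
    by_cases hxy : x = y
    · subst hxy; simp
    · simp [hxy, Ne.symm hxy]
  | succ n ih =>
    rw [add_comm n 1, ck 1 n y x, add_comm 1 n]
    simp only [ePn_one]
    rw [ePn, ← ENNReal.tsum_mul_left, ← ENNReal.tsum_mul_left]
    congr 1; ext z
    rw [← mul_assoc, ih, mul_right_comm, h.pi_rev]; ring

theorem two_mul_le (a b : ℝ≥0∞) : 2 * (a * b) ≤ a ^ 2 + b ^ 2 := by
  by_cases ha : a = ⊤
  · simp [ha]
  by_cases hb : b = ⊤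
  · simp [hb]
  lift a to NNReal using ha
  lift b to NNReal using hb
  norm_cast
  have : (2 * (a * b) : ℝ) ≤ a ^ 2 + b ^ 2 := by nlinarith [sq_nonneg ((a:ℝ) - b)]
  exact_mod_cast this

theorem combine (h : Chain P π γ) (m n : ℕ) (x y : V) (ε : ℝ≥0∞)
    (h1 : ∑' z, ePn P m x z ^ 2 / π z ≤ ε) (h2 : ∑' z, ePn (rev P π) n y z ^ 2 / π z ≤ ε) :
    ePn P (m + n) x y ≤ π y * ε := by
  have e1 : ePn P (m + n) x y = π y * ∑' z, ePn P m x z * ePn (rev P π) n y z / π z := by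
    rw [ck, ← ENNReal.tsum_mul_left]
    congr 1; ext z
    have : ePn P n z y = π y * ePn (rev P π) n y z / π z := by
      rw [h.ePn_rev, mul_comm, ENNReal.mul_div_cancel_right (h.pi0 z) (h.pitop z)]
    rw [this]
    simp only [div_eq_mul_inv]; ring
  rw [e1]
  gcongr
  refine (ENNReal.mul_le_mul_iff_right (a := 2) (by simp) (by simp)).1 ?_
  calc 2 * ∑' z, ePn P m x z * ePn (rev P π) n y z / π z
      ≤ ∑' z, ePn P m x z ^ 2 / π z + ∑' z, ePn (rev P π) n y z ^ 2 / π z := by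
        rw [← ENNReal.tsum_mul_left, ← ENNReal.tsum_add]
        refine ENNReal.tsum_le_tsum fun z => ?_
        rw [← mul_div_assoc, ← ENNReal.add_div]
        gcongr
        exact two_mul_le _ _
    _ ≤ ε + ε := add_le_add h1 h2
    _ = 2 * ε := (two_mul ε).symm

theorem ePn_row (h : Chain P π γ) (n : ℕ) (x : V) : ∑' y, ePn P n x y = 1 := by
  induction n with
  | zero => simp [ePn]
  | succ n ih =>
    simp only [ePn]
    rw [ENNReal.tsum_comm]
    simp_rw [ENNReal.tsum_mul_left, h.row, mul_one]
    exact ih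

end Chain
end Rev
section Transfer
variable {V : Type*}

theorem piS_eq (pi : V → ℝ) (hpi : ∀ x, 0 < pi x) (S : Set V) :
    piS pi S = (eM (fun x => ENNReal.ofReal (pi x)) S).toReal := by
  rw [piS, eM, ← tsum_subtype, ENNReal.tsum_toReal_eq (fun _ => ENNReal.ofReal_ne_top)]
  congr 1; ext y
  rw [ENNReal.toReal_ofReal (hpi y).le]

theorem QS_eq (pi : V → ℝ) (p : V → V → ℝ) (hpi : ∀ x, 0 < pi x) (hp0 : ∀ x y, 0 ≤ p x y)
    (S : Set V) (y : V) :
    QS pi p S y = (eQ (fun x y => ENNReal.ofReal (p x y)) (fun x => ENNReal.ofReal (pi x)) S y).toReal := by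
  rw [QS, eQ, ← tsum_subtype, ENNReal.tsum_toReal_eq
    (fun _ => ENNReal.mul_ne_top ENNReal.ofReal_ne_top ENNReal.ofReal_ne_top)]
  congr 1; ext s
  rw [ENNReal.toReal_mul, ENNReal.toReal_ofReal (hpi s).le, ENNReal.toReal_ofReal (hp0 _ _)]

theorem pn_eq (p : V → V → ℝ) (hp0 : ∀ x y, 0 ≤ p x y)
    (hfin : ∀ n x y, ePn (fun x y => ENNReal.ofReal (p x y)) n x y ≠ ⊤) (n : ℕ) (x y : V) :
    pn p n x y = (ePn (fun x y => ENNReal.ofReal (p x y)) n x y).toReal := by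
  induction n generalizing y with
  | zero => simp only [pn, ePn]; split_ifs <;> simp
  | succ n ih =>
    simp only [pn, ePn]
    rw [ENNReal.tsum_toReal_eq (fun z => ENNReal.mul_ne_top (hfin n x z) ENNReal.ofReal_ne_top)]
    congr 1; ext z
    rw [ENNReal.toReal_mul, ← ih, ENNReal.toReal_ofReal (hp0 _ _)]

end Transfer

end Helpers

/-- Theorem 2 (infinite stationary measure case): heat kernel bound from the
conductance profile. -/
theorem heat_kernel_bound_infinite_measure [Countable V] [Nonempty V]
    (p : V → V → ℝ) (pi : V → ℝ)
    (hp0 : ∀ x y, 0 ≤ p x y) (hp1 : ∀ x, ∑' y, p x y = 1)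
    (hpipos : ∀ x, 0 < pi x) (hpiinf : ¬ Summable pi)
    (hstat : ∀ y, ∑' x, pi x * p x y = pi y)
    (hirr : ∀ x y : V, ∃ n, 0 < pn p n x y)
    (γ : ℝ) (hγ0 : 0 < γ) (hγ : γ ≤ 1 / 2)
    (hlazy : ∀ x, γ ≤ p x x)
    (ε : ℝ) (hε : 0 < ε) :
    ∀ (x y : V) (n : ℕ),
      1 + ENNReal.ofReal ((1 - γ) ^ 2 / γ ^ 2) *
          (∫⁻ u in Ioc (4 * min (pi x) (pi y)) (4 / ε),
            4 / ENNReal.ofReal (u * profileInf pi p u ^ 2)) ≤ (n : ℝ≥0∞) →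
      pn p n x y / pi y ≤ ε := by
  intro x y n hn
  set P : V → V → ℝ≥0∞ := fun x y => ENNReal.ofReal (p x y) with hP
  set π : V → ℝ≥0∞ := fun x => ENNReal.ofReal (pi x) with hπ
  have g2 : 0 < 1 - γ := by linarith
  have h : Chain P π γ :=
    { pi0 := fun x => by simpa [hπ] using hpipos x
      pitop := fun x => ENNReal.ofReal_ne_top
      row := fun x => by
        have : (∑' y, P x y).toReal = 1 := by
          rw [ENNReal.tsum_toReal_eq (fun _ => ENNReal.ofReal_ne_top), ← hp1 x]
          congr 1; ext y
          exact ENNReal.toReal_ofReal (hp0 _ _)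
        exact (ENNReal.toReal_eq_one_iff _).1 this
      stat := fun y => by
        have : (∑' x, π x * P x y).toReal = pi y := by
          rw [ENNReal.tsum_toReal_eq
            (fun _ => ENNReal.mul_ne_top ENNReal.ofReal_ne_top ENNReal.ofReal_ne_top), ← hstat y]
          congr 1; ext x
          rw [ENNReal.toReal_mul, ENNReal.toReal_ofReal (hpipos x).le, ENNReal.toReal_ofReal (hp0 _ _)]
        have ht : (∑' x, π x * P x y) ≠ ⊤ := by
          intro ht
          rw [ht] at this
          exact (hpipos y).ne this
        rw [← ENNReal.ofReal_toReal ht, this]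
      g0 := hγ0
      g1 := hγ
      lazy := fun x => ENNReal.ofReal_le_ofReal (hlazy x) }
  have hfin : ∀ n x y, ePn P n x y ≠ ⊤ := fun n x y =>
    ne_top_of_le_ne_top ENNReal.one_ne_top ((ENNReal.le_tsum y).trans (h.ePn_row n x).le)
  have hcond : ∀ S, cond pi p S = (eB P π S).toReal / (eM π S).toReal := by
    intro S
    rw [cond, piS_eq pi hpipos, Qset, eB, ← tsum_subtype, ENNReal.tsum_toReal_eq
      (fun a : ↥(Sᶜ) => ne_top_of_le_ne_top (h.pitop a) (h.Q_le S a))]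
    congr 2; ext a
    exact QS_eq pi p hpipos hp0 S a
  have hcond0 : ∀ S, 0 ≤ cond pi p S := fun S => by
    rw [hcond]; positivity
  have hbdd : ∀ r, BddBelow (cond pi p '' {S : Set V | 0 < piS pi S ∧ piS pi S ≤ r}) := by
    intro r
    refine ⟨0, ?_⟩
    rintro _ ⟨S, -, rfl⟩
    exact hcond0 S
  set Φ := profileInf pi p with hΦd
  have hΦ0 : ∀ u, 0 ≤ Φ u := by
    intro u
    refine Real.sInf_nonneg ?_
    rintro _ ⟨S, -, rfl⟩
    exact hcond0 S
  have hpix : ∀ x, (π x).toReal = pi x := fun x => ENNReal.toReal_ofReal (hpipos x).le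
  have hΦm : ∀ x r r', (π x).toReal ≤ r → r ≤ r' → Φ r' ≤ Φ r := by
    intro x r r' h1 h2
    refine csInf_le_csInf (hbdd r') ?_ ?_
    · refine ⟨_, {x}, ⟨?_, ?_⟩, rfl⟩
      · rw [piS_eq pi hpipos, Chain.eM_singleton, ENNReal.toReal_ofReal (hpipos x).le]
        exact hpipos x
      · rw [piS_eq pi hpipos, Chain.eM_singleton]; exact h1
    · exact image_mono fun S hS => ⟨hS.1, hS.2.trans h2⟩
  have hΦ : ∀ r S, eM π S ≠ 0 → eM π S ≤ ENNReal.ofReal r →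
      ENNReal.ofReal (Φ r) * eM π S ≤ eB P π S := by
    intro r S hS0 hSr
    have hSt : eM π S ≠ ⊤ := ne_top_of_le_ne_top ENNReal.ofReal_ne_top hSr
    have hpos : 0 < (eM π S).toReal := ENNReal.toReal_pos hS0 hSt
    have hle : Φ r ≤ cond pi p S := by
      refine csInf_le (hbdd r) ⟨S, ⟨?_, ?_⟩, rfl⟩
      · rw [piS_eq pi hpipos]; exact hpos
      · rw [piS_eq pi hpipos]
        have hr0 : 0 < r := by
          by_contra hc
          rw [ENNReal.ofReal_of_nonpos (not_lt.1 hc)] at hSr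
          exact hS0 (le_antisymm hSr zero_le)
        exact ENNReal.toReal_le_of_le_ofReal hr0.le hSr
    rw [hcond, le_div_iff₀ hpos] at hle
    have hBt : eB P π S ≠ ⊤ := ne_top_of_le_ne_top hSt (h.eB_add S ▸ le_add_self)
    rw [← ENNReal.ofReal_toReal hSt, ← ENNReal.ofReal_toReal hBt, ← ENNReal.ofReal_mul (hΦ0 r)]
    exact ENNReal.ofReal_le_ofReal hle
  have hΦ' : ∀ r S, eM π S ≠ 0 → eM π S ≤ ENNReal.ofReal r →
      ENNReal.ofReal (Φ r) * eM π S ≤ eB (Chain.rev P π) π S := by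
    intro r S hS0 hSr
    rw [h.eB_rev S (ne_top_of_le_ne_top ENNReal.ofReal_ne_top hSr)]
    exact hΦ r S hS0 hSr
  -- the integral bound
  set J := ∫⁻ u in Ioc (4 * min (pi x) (pi y)) (4 / ε), 4 / ENNReal.ofReal (u * Φ u ^ 2) with hJ
  have hJb : ∀ m : ℕ, n ≤ 2 * m + 1 →
      J ≤ ENNReal.ofReal (4 * (γ ^ 2 / (2 * (1 - γ) ^ 2)) * m) := by
    intro m hm
    have h1 : (1:ℝ≥0∞) + ENNReal.ofReal ((1 - γ) ^ 2 / γ ^ 2) * J ≤ 1 + 2 * m := by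
      refine hn.trans ?_
      rw [add_comm]; exact_mod_cast hm
    have h2 : ENNReal.ofReal ((1 - γ) ^ 2 / γ ^ 2) * J ≤ 2 * m :=
      (ENNReal.add_le_add_iff_left ENNReal.one_ne_top).1 h1
    have hK : 0 < (1 - γ) ^ 2 / γ ^ 2 := by positivity
    refine (ENNReal.mul_le_mul_iff_right (a := ENNReal.ofReal ((1 - γ) ^ 2 / γ ^ 2))
      (by simpa using hK) ENNReal.ofReal_ne_top).1 (h2.trans ?_)
    rw [← ENNReal.ofReal_mul hK.le]
    have : (1 - γ) ^ 2 / γ ^ 2 * (4 * (γ ^ 2 / (2 * (1 - γ) ^ 2)) * m) = ((2 * m : ℕ) : ℝ) := by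
      push_cast; field_simp; norm_num
    rw [this, ENNReal.ofReal_natCast]
    push_cast; exact le_rfl
  have b1 := h.core x Φ hΦ0 (hΦm x) hΦ ε hε (n / 2) (by
    refine le_trans (lintegral_mono_set (Ioc_subset_Ioc_left ?_)) (hJb (n / 2) (by omega))
    rw [hpix]; gcongr; exact min_le_left _ _)
  have b2 := h.chain_rev.core y Φ hΦ0 (hΦm y) hΦ' ε hε (n - n / 2) (by
    refine le_trans (lintegral_mono_set (Ioc_subset_Ioc_left ?_)) (hJb (n - n / 2) (by omega))
    rw [hpix]; gcongr; exact min_le_right _ _)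
  have hc := h.combine (n / 2) (n - n / 2) x y _ b1 b2
  rw [show n / 2 + (n - n / 2) = n by omega] at hc
  rw [pn_eq p hp0 hfin, div_le_iff₀ (hpipos y)]
  refine ENNReal.toReal_le_of_le_ofReal (mul_nonneg hε.le (hpipos y).le) ?_
  rw [mul_comm, ENNReal.ofReal_mul (hpipos y).le]
  exact hc

end EvolvingSetsPaper
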